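/- For 0 < u < v < 1 define p(u,v,w) := Φ( √2 [ Φ⁻¹(u) − √( (Φ⁻¹(v) − Φ⁻¹(u)) (Φ⁻¹(w) − Φ⁻¹(u)) ) ] ) for v < w < 1, and G(u,v) := (1/(1−v)) ∫_v^1 p(u,v,w) dw. Set I_n := n(n−1)(n−2) ∫₀¹ ∫₀^v (1−v)^{n−2} G(u,v) du dv. Then lim_{n→∞} n √(log n) · I_n = 3√(π/2). -/

import Mathlib

open Filter Set

/-- The standard normal cumulative distribution function
`Φ(t) = ∫_{-∞}^t e^{-z²/2}/√(2π) dz`. -/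
noncomputable def stdNormalCDF (t : ℝ) : ℝ :=
  ∫ z in Set.Iic t, Real.exp (-z ^ 2 / 2) / Real.sqrt (2 * Real.pi)

/-- The inverse function `Φ⁻¹ : (0,1) → ℝ` of the standard normal CDF. -/
noncomputable def stdNormalCDFInv : ℝ → ℝ :=
  Function.invFun stdNormalCDF

/-- The pair probability
`p(u,v,w) = Φ(√2[Φ⁻¹(u) − √((Φ⁻¹(v)−Φ⁻¹(u))(Φ⁻¹(w)−Φ⁻¹(u)))])`. -/
noncomputable def pPair (u v w : ℝ) : ℝ :=
  stdNormalCDF (Real.sqrt 2 * (stdNormalCDFInv u -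
    Real.sqrt ((stdNormalCDFInv v - stdNormalCDFInv u) *
      (stdNormalCDFInv w - stdNormalCDFInv u))))

/-- The averaged edge-probability function
`G(u,v) = (1/(1−v)) ∫_v^1 p(u,v,w) dw` (which at `v = u` coincides with the
continuous extension from `v > u`). -/
noncomputable def Gavg (u v : ℝ) : ℝ :=
  (1 / (1 - v)) * ∫ w in Set.Ioo v 1, pPair u v w


open MeasureTheory Topology

/-- The standard normal density. -/
noncomputable def gphi (x : ℝ) : ℝ := Real.exp (-x ^ 2 / 2) / Real.sqrt (2 * Real.pi)

lemma gphi_pos (x : ℝ) : 0 < gphi x := by unfold gphi; positivity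

lemma gphi_cont : Continuous gphi := by unfold gphi; fun_prop

lemma gphi_eq (x : ℝ) : gphi x = ProbabilityTheory.gaussianPDFReal 0 1 x := by
  simp [gphi, ProbabilityTheory.gaussianPDFReal]; ring

lemma gphi_integrable : Integrable gphi := by
  have : gphi = ProbabilityTheory.gaussianPDFReal 0 1 := funext gphi_eq
  rw [this]; exact ProbabilityTheory.integrable_gaussianPDFReal 0 1

lemma gphi_integral : ∫ x, gphi x = 1 := by
  have : gphi = ProbabilityTheory.gaussianPDFReal 0 1 := funext gphi_eq
  rw [this]; exact ProbabilityTheory.integral_gaussianPDFReal_eq_one 0 one_ne_zero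

lemma Phi_def (t : ℝ) : stdNormalCDF t = ∫ z in Set.Iic t, gphi z := rfl

lemma Phi_cdf (t : ℝ) : stdNormalCDF t = ProbabilityTheory.cdf (ProbabilityTheory.gaussianReal 0 1) t := by
  rw [ProbabilityTheory.cdf_eq_real, Measure.real,
    ProbabilityTheory.gaussianReal_apply_eq_integral _ one_ne_zero, ENNReal.toReal_ofReal, Phi_def]
  · simp_rw [gphi_eq]
  · exact integral_nonneg fun x => ProbabilityTheory.gaussianPDFReal_nonneg _ _ _

lemma Phi_atTop : Tendsto stdNormalCDF atTop (𝓝 1) := by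
  have : stdNormalCDF = ProbabilityTheory.cdf (ProbabilityTheory.gaussianReal 0 1) := funext Phi_cdf
  rw [this]; exact ProbabilityTheory.tendsto_cdf_atTop _

lemma Phi_atBot : Tendsto stdNormalCDF atBot (𝓝 0) := by
  have : stdNormalCDF = ProbabilityTheory.cdf (ProbabilityTheory.gaussianReal 0 1) := funext Phi_cdf
  rw [this]; exact ProbabilityTheory.tendsto_cdf_atBot _

lemma Phi_deriv (t : ℝ) : HasDerivAt stdNormalCDF (gphi t) t := by
  have h : stdNormalCDF = fun t => stdNormalCDF 0 + ∫ z in (0:ℝ)..t, gphi z := by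
    funext t
    rw [← intervalIntegral.integral_Iic_sub_Iic gphi_integrable.integrableOn gphi_integrable.integrableOn, Phi_def, Phi_def]
    ring
  rw [h]
  exact (gphi_cont.integral_hasStrictDerivAt 0 t).hasDerivAt.const_add _

lemma Phi_cont : Continuous stdNormalCDF :=
  continuous_iff_continuousAt.2 fun t => (Phi_deriv t).continuousAt

lemma Phi_strictMono : StrictMono stdNormalCDF :=
  strictMono_of_deriv_pos fun t => by rw [(Phi_deriv t).deriv]; exact gphi_pos t

lemma Phi_pos (t : ℝ) : 0 < stdNormalCDF t :=
  lt_of_le_of_lt (by rw [Phi_cdf]; exact ProbabilityTheory.cdf_nonneg _ _) (Phi_strictMono (sub_one_lt t))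

lemma Phi_lt_one (t : ℝ) : stdNormalCDF t < 1 :=
  lt_of_lt_of_le (Phi_strictMono (lt_add_one t)) (by rw [Phi_cdf]; exact ProbabilityTheory.cdf_le_one _ _)

lemma Phi_surj {u : ℝ} (h0 : 0 < u) (h1 : u < 1) : ∃ t, stdNormalCDF t = u := by
  obtain ⟨a, ha⟩ := (Phi_atBot.eventually (gt_mem_nhds h0)).exists
  obtain ⟨b, hb⟩ := (Phi_atTop.eventually (lt_mem_nhds h1)).exists
  have := mem_range_of_exists_le_of_exists_ge Phi_cont ⟨a, ha.le⟩ ⟨b, hb.le⟩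
  exact this

lemma Inv_Phi (t : ℝ) : stdNormalCDFInv (stdNormalCDF t) = t :=
  Function.leftInverse_invFun Phi_strictMono.injective t

lemma Phi_Inv {u : ℝ} (h0 : 0 < u) (h1 : u < 1) : stdNormalCDF (stdNormalCDFInv u) = u := by
  obtain ⟨t, rfl⟩ := Phi_surj h0 h1
  rw [Inv_Phi]

lemma Inv_meas : Measurable stdNormalCDFInv := by
  have h := (Phi_cont.measurableEmbedding Phi_strictMono.injective).measurable_extend
    (g := id) (g' := fun _ => Classical.arbitrary ℝ) measurable_id measurable_const
  exact h

lemma Inv_tendsto : Tendsto (fun v => - stdNormalCDFInv v) (𝓝[>] 0) atTop := by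
  rw [tendsto_atTop]
  intro c
  have : Set.Ioo 0 (stdNormalCDF (-c)) ∈ 𝓝[>] (0:ℝ) := Ioo_mem_nhdsGT (Phi_pos _)
  filter_upwards [this] with v hv
  have h1 : v < 1 := hv.2.trans (Phi_lt_one _)
  have h2 := hv.2
  rw [← Phi_Inv hv.1 h1, Phi_strictMono.lt_iff_lt] at h2
  linarith

lemma gphi_deriv (t : ℝ) : HasDerivAt gphi (-t * gphi t) t := by
  have h : HasDerivAt (fun x : ℝ => -x ^ 2 / 2) (-t) t := by
    exact (((hasDerivAt_pow 2 t).neg).div_const 2).congr_deriv (by simp; ring)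
  exact (h.exp.div_const (Real.sqrt (2 * Real.pi))).congr_deriv (by unfold gphi; ring)

lemma gphi_neg (t : ℝ) : gphi (-t) = gphi t := by simp [gphi]

lemma PhiN_deriv (t : ℝ) : HasDerivAt (fun t => stdNormalCDF (-t)) (- gphi t) t := by
  have := (Phi_deriv (-t)).comp t (hasDerivAt_neg t)
  rw [gphi_neg] at this
  exact this.congr_deriv (by ring)

lemma Q_deriv {t : ℝ} (ht : 0 < t) :
    HasDerivAt (fun t => gphi t / t) (- gphi t * (1 + 1 / t ^ 2)) t := by
  exact ((gphi_deriv t).div (hasDerivAt_id t) ht.ne').congr_deriv (by simp; field_simp; ring)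

lemma gphi_atTop : Tendsto gphi atTop (𝓝 0) := by
  have h1 : Tendsto (fun x : ℝ => -x ^ 2 / 2) atTop atBot := by
    have : Tendsto (fun x : ℝ => x ^ 2 / 2) atTop atTop :=
      (tendsto_pow_atTop two_ne_zero).atTop_div_const two_pos
    refine (tendsto_neg_atTop_atBot.comp this).congr fun x => ?_
    simp [neg_div]
  have := (Real.tendsto_exp_atBot.comp h1).div_const (Real.sqrt (2 * Real.pi))
  rw [zero_div] at this
  exact this

lemma Q_atTop : Tendsto (fun t => gphi t / t) atTop (𝓝 0) := by
  simpa [div_eq_mul_inv] using gphi_atTop.mul tendsto_inv_atTop_zero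

lemma PhiN_atTop : Tendsto (fun t => stdNormalCDF (-t)) atTop (𝓝 0) :=
  Phi_atBot.comp tendsto_neg_atTop_atBot

lemma mills_le {t : ℝ} (ht : 0 < t) : stdNormalCDF (-t) ≤ gphi t / t := by
  have hanti : AntitoneOn (fun t => gphi t / t - stdNormalCDF (-t)) (Set.Ioi 0) := by
    apply antitoneOn_of_deriv_nonpos (convex_Ioi 0)
    · intro x hx
      exact ((Q_deriv hx).sub (PhiN_deriv x)).continuousAt.continuousWithinAt
    · intro x hx
      rw [interior_Ioi] at hx
      exact ((Q_deriv hx).sub (PhiN_deriv x)).differentiableAt.differentiableWithinAt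
    · intro x hx
      rw [interior_Ioi] at hx
      have hd : deriv (fun t => gphi t / t - stdNormalCDF (-t)) x = _ :=
        ((Q_deriv hx).sub (PhiN_deriv x)).deriv
      rw [hd]
      have := gphi_pos x
      have h2 : 0 ≤ gphi x * (1 / x ^ 2) := by positivity
      linarith
  have hlim := Q_atTop.sub PhiN_atTop
  rw [sub_zero] at hlim
  have h0 : 0 ≤ gphi t / t - stdNormalCDF (-t) := by
    apply le_of_tendsto hlim
    filter_upwards [eventually_ge_atTop t] with s hs
    exact hanti ht (ht.trans_le hs) hs
  linarith

lemma mills_lim : Tendsto (fun t => stdNormalCDF (-t) * t / gphi t) atTop (𝓝 1) := by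
  have : Tendsto (fun t => stdNormalCDF (-t) / (gphi t / t)) atTop (𝓝 1) := by
    apply HasDerivAt.lhopital_zero_atTop (f' := fun t => - gphi t) (g' := fun t => - gphi t * (1 + 1 / t ^ 2))
    · exact Eventually.of_forall PhiN_deriv
    · filter_upwards [eventually_gt_atTop 0] with t ht using Q_deriv ht
    · filter_upwards [eventually_gt_atTop 0] with t ht
      have := gphi_pos t
      have : 0 < gphi t * (1 + 1 / t ^ 2) := by positivity
      linarith
    · exact PhiN_atTop
    · exact Q_atTop
    · have h : Tendsto (fun t : ℝ => (1 + 1 / t ^ 2)⁻¹) atTop (𝓝 1) := by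
        have h1 : Tendsto (fun t : ℝ => 1 / t ^ 2) atTop (𝓝 0) := by
          simp_rw [one_div]
          exact tendsto_inv_atTop_zero.comp (tendsto_pow_atTop (α := ℝ) two_ne_zero)
        simpa using (h1.const_add 1).inv₀ (by norm_num)
      refine h.congr fun t => ?_
      have := (gphi_pos t).ne'
      rw [div_mul_eq_div_div, div_self (neg_ne_zero.2 this), ← one_div]
  refine this.congr fun t => ?_
  rw [div_div_eq_mul_div]

/-- The point `a = b + y²/b³`. -/
noncomputable def afun (b y : ℝ) : ℝ := b + y ^ 2 / b ^ 3

/-- The argument of the tail in the rescaled variables. -/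
noncomputable def zfun (b y x : ℝ) : ℝ :=
  afun b y + Real.sqrt ((y ^ 2 / b ^ 3) * (afun b y + x))

/-- The inner integral. -/
noncomputable def Hfun (v : ℝ) : ℝ := ∫ u in Set.Ioo (0 : ℝ) v, Gavg u v

lemma Phi_image (b : ℝ) : stdNormalCDF '' Set.Ioi (-b) = Set.Ioo (stdNormalCDF (-b)) 1 := by
  ext w
  constructor
  · rintro ⟨x, hx, rfl⟩
    exact ⟨Phi_strictMono hx, Phi_lt_one x⟩
  · rintro ⟨h1, h2⟩
    obtain ⟨t, rfl⟩ := Phi_surj ((Phi_pos _).trans h1) h2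
    exact ⟨t, Phi_strictMono.lt_iff_lt.1 h1, rfl⟩

lemma Phi_image2 {b : ℝ} (hb : 0 < b) :
    (fun y => stdNormalCDF (-afun b y)) '' Set.Ioi 0 = Set.Ioo 0 (stdNormalCDF (-b)) := by
  ext w
  constructor
  · rintro ⟨y, hy, rfl⟩
    refine ⟨Phi_pos _, Phi_strictMono ?_⟩
    have hy : 0 < y := hy
    have : 0 < y ^ 2 / b ^ 3 := by positivity
    unfold afun; linarith
  · rintro ⟨h1, h2⟩
    obtain ⟨t, rfl⟩ := Phi_surj h1 (h2.trans (Phi_lt_one _))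
    have h3 := Phi_strictMono.lt_iff_lt.1 h2
    have h4 : 0 < b ^ 3 * (-t - b) := mul_pos (by positivity) (by linarith)
    refine ⟨Real.sqrt (b ^ 3 * (-t - b)), Real.sqrt_pos.2 h4, ?_⟩
    have : afun b (Real.sqrt (b ^ 3 * (-t - b))) = -t := by
      unfold afun
      rw [Real.sq_sqrt h4.le]
      field_simp
      ring
    simp [this]

lemma afun_inj {b : ℝ} (hb : 0 < b) : Set.InjOn (fun y => stdNormalCDF (-afun b y)) (Set.Ioi 0) := by
  intro y hy y' hy' h
  have h := Phi_strictMono.injective h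
  have hy : 0 < y := hy
  have hy' : 0 < y' := hy'
  unfold afun at h
  have h2 : y ^ 2 / b ^ 3 = y' ^ 2 / b ^ 3 := by linarith
  have h3 : y ^ 2 = y' ^ 2 := by
    field_simp at h2
    exact h2
  exact (pow_left_inj₀ hy.le hy'.le two_ne_zero).1 h3

lemma pPair_Phi (b y x : ℝ) :
    pPair (stdNormalCDF (-afun b y)) (stdNormalCDF (-b)) (stdNormalCDF x)
      = stdNormalCDF (-(Real.sqrt 2 * zfun b y x)) := by
  unfold pPair
  rw [Inv_Phi, Inv_Phi, Inv_Phi]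
  congr 1
  unfold zfun
  have : (-b - -afun b y) * (x - -afun b y) = (y ^ 2 / b ^ 3) * (afun b y + x) := by
    unfold afun; ring
  rw [this]; ring

lemma afun_deriv (b y : ℝ) : HasDerivAt (fun y => stdNormalCDF (-afun b y))
    (-(gphi (afun b y) * (2 * y / b ^ 3))) y := by
  have h : HasDerivAt (fun y => afun b y) (2 * y / b ^ 3) y := by
    have := ((hasDerivAt_pow 2 y).div_const (b ^ 3)).const_add b
    exact this.congr_deriv (by simp)
  exact ((PhiN_deriv (afun b y)).comp y h).congr_deriv (by ring)

lemma Gavg_Phi (b y : ℝ) : Gavg (stdNormalCDF (-afun b y)) (stdNormalCDF (-b)) =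
    1 / (1 - stdNormalCDF (-b)) *
      ∫ x in Set.Ioi (-b), gphi x * stdNormalCDF (-(Real.sqrt 2 * zfun b y x)) := by
  unfold Gavg
  rw [← Phi_image, integral_image_eq_integral_abs_deriv_smul measurableSet_Ioi
    (fun x _ => (Phi_deriv x).hasDerivWithinAt) Phi_strictMono.injective.injOn]
  simp_rw [pPair_Phi, abs_of_pos (gphi_pos _), smul_eq_mul]

lemma Hfun_Phi {b : ℝ} (hb : 0 < b) : Hfun (stdNormalCDF (-b)) =
    1 / (1 - stdNormalCDF (-b)) * ∫ y in Set.Ioi (0:ℝ), (gphi (afun b y) * (2 * y / b ^ 3)) *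
      ∫ x in Set.Ioi (-b), gphi x * stdNormalCDF (-(Real.sqrt 2 * zfun b y x)) := by
  unfold Hfun
  rw [← Phi_image2 hb, integral_image_eq_integral_abs_deriv_smul measurableSet_Ioi
    (fun x _ => (afun_deriv b x).hasDerivWithinAt) (afun_inj hb), ← integral_const_mul]
  apply setIntegral_congr_fun measurableSet_Ioi
  intro y hy
  have hy : 0 < y := hy
  have : 0 < gphi (afun b y) * (2 * y / b ^ 3) := mul_pos (gphi_pos _) (by positivity)
  simp only [Gavg_Phi, abs_neg, abs_of_pos this, smul_eq_mul]
  ring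

/-- The normalised kernel. -/
noncomputable def Eker (b y x : ℝ) : ℝ :=
  (Set.Ioi (-b)).indicator (fun x => b ^ 4 / gphi b ^ 3 * (gphi (afun b y) * (2 * y / b ^ 3)) *
    (gphi x * stdNormalCDF (-(Real.sqrt 2 * zfun b y x)))) x

lemma Hfun_Eker {b : ℝ} (hb : 0 < b) : Hfun (stdNormalCDF (-b)) =
    gphi b ^ 3 / b ^ 4 / (1 - stdNormalCDF (-b)) * ∫ y in Set.Ioi (0:ℝ), ∫ x, Eker b y x := by
  have h : ∀ y, ∫ x, Eker b y x = b ^ 4 / gphi b ^ 3 * ((gphi (afun b y) * (2 * y / b ^ 3)) *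
      ∫ x in Set.Ioi (-b), gphi x * stdNormalCDF (-(Real.sqrt 2 * zfun b y x))) := by
    intro y
    unfold Eker
    rw [integral_indicator measurableSet_Ioi, integral_const_mul, mul_assoc]
  simp_rw [h]
  rw [integral_const_mul, Hfun_Phi hb]
  have := (gphi_pos b).ne'
  have h1 : 1 - stdNormalCDF (-b) ≠ 0 := (sub_pos.2 (Phi_lt_one _)).ne'
  generalize (∫ y in Set.Ioi (0:ℝ), (gphi (afun b y) * (2 * y / b ^ 3)) *
      ∫ x in Set.Ioi (-b), gphi x * stdNormalCDF (-(Real.sqrt 2 * zfun b y x))) = J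
  field_simp

lemma Eker_meas (b : ℝ) : Measurable (fun q : ℝ × ℝ => Eker b q.1 q.2) := by
  have h1 : Measurable (fun q : ℝ × ℝ => b ^ 4 / gphi b ^ 3 * (gphi (afun b q.1) * (2 * q.1 / b ^ 3)) *
    (gphi q.2 * stdNormalCDF (-(Real.sqrt 2 * zfun b q.1 q.2)))) := by
    have := gphi_cont
    have := Phi_cont
    have : Continuous (fun y => afun b y) := by unfold afun; fun_prop
    have : Continuous (fun q : ℝ × ℝ => zfun b q.1 q.2) := by unfold zfun; fun_prop
    apply Continuous.measurable
    fun_prop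
  have h2 : MeasurableSet {q : ℝ × ℝ | q.2 ∈ Set.Ioi (-b)} := measurable_snd measurableSet_Ioi
  exact h1.indicator h2

lemma exp_bd {s : ℝ} (hs : 0 ≤ s) : Real.exp (-s) ≤ 4 / (1 + s) ^ 2 := by
  rw [Real.exp_neg, le_div_iff₀ (by positivity), inv_mul_le_iff₀ (Real.exp_pos _)]
  have h : s / 2 + 1 ≤ Real.exp (s / 2) := Real.add_one_le_exp _
  have h2 : Real.exp s = Real.exp (s / 2) ^ 2 := by rw [← Real.exp_nat_mul]; congr 1; push_cast; ring
  rw [h2]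
  nlinarith

lemma exp_bd4 {s : ℝ} (hs : 0 ≤ s) : Real.exp (-s) ≤ 256 / (1 + s ^ 2) ^ 2 := by
  rw [Real.exp_neg, le_div_iff₀ (by positivity), inv_mul_le_iff₀ (Real.exp_pos _)]
  have h : s / 4 + 1 ≤ Real.exp (s / 4) := Real.add_one_le_exp _
  have h2 : Real.exp s = Real.exp (s / 4) ^ 4 := by rw [← Real.exp_nat_mul]; congr 1; push_cast; ring
  rw [h2]
  have h3 : (s / 4 + 1) ^ 4 ≤ Real.exp (s / 4) ^ 4 := pow_le_pow_left₀ (by positivity) h 4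
  have h4 : (1 + s ^ 2) ^ 2 ≤ ((1 + s) ^ 2) ^ 2 := pow_le_pow_left₀ (by positivity) (by nlinarith) 2
  have h5 : (1 + s) ^ 4 ≤ (s + 4) ^ 4 := pow_le_pow_left₀ (by positivity) (by linarith) 4
  nlinarith

lemma gphi_ratio (a b z : ℝ) : gphi a * gphi (Real.sqrt 2 * z) / gphi b ^ 3 =
    Real.sqrt (2 * Real.pi) * Real.exp (-((a ^ 2 - b ^ 2) / 2 + (z ^ 2 - b ^ 2))) := by
  unfold gphi
  have h : Real.exp (-b ^ 2 / 2) ≠ 0 := (Real.exp_pos _).ne'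
  have h2 : Real.exp (-a ^ 2 / 2) * Real.exp (-(Real.sqrt 2 * z) ^ 2 / 2) =
      Real.exp (-((a ^ 2 - b ^ 2) / 2 + (z ^ 2 - b ^ 2))) * Real.exp (-b ^ 2 / 2) ^ 3 := by
    rw [← Real.exp_nat_mul, ← Real.exp_add, ← Real.exp_add, mul_pow, Real.sq_sqrt two_pos.le]
    congr 1; push_cast; ring
  have h3 : Real.sqrt (2 * Real.pi) ≠ 0 := by positivity
  rw [div_mul_div_comm, h2]
  field_simp

lemma zfun_sub {b y x : ℝ} (hb : 0 < b) (hy : 0 ≤ y) : b * (zfun b y x - b) =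
    y ^ 2 / b ^ 2 + y * Real.sqrt (1 + y ^ 2 / b ^ 4 + x / b) := by
  have : b * Real.sqrt ((y ^ 2 / b ^ 3) * (afun b y + x)) =
      y * Real.sqrt (1 + y ^ 2 / b ^ 4 + x / b) := by
    nth_rewrite 1 [← Real.sqrt_sq hb.le]
    rw [← Real.sqrt_mul (by positivity)]
    have e : y * Real.sqrt (1 + y ^ 2 / b ^ 4 + x / b) =
        Real.sqrt (y ^ 2 * (1 + y ^ 2 / b ^ 4 + x / b)) := by
      rw [Real.sqrt_mul (by positivity), Real.sqrt_sq hy]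
    rw [e]
    congr 1
    unfold afun; field_simp
  have h2 : b * (zfun b y x - b) = y ^ 2 / b ^ 2 + b * Real.sqrt ((y ^ 2 / b ^ 3) * (afun b y + x)) := by
    unfold zfun
    have : b * (afun b y - b) = y ^ 2 / b ^ 2 := by unfold afun; field_simp; ring
    rw [← this]; ring
  rw [h2, this]

lemma Eker_nonneg {b y x : ℝ} (hb : 0 < b) (hy : 0 < y) : 0 ≤ Eker b y x := by
  unfold Eker
  apply Set.indicator_nonneg
  intro x _
  have := gphi_pos b
  have := gphi_pos x
  have := gphi_pos (afun b y)
  have := Phi_pos (-(Real.sqrt 2 * zfun b y x))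
  positivity

set_option maxHeartbeats 800000 in
lemma Eker_bound {b y x : ℝ} (hb : 0 < b) (hy : 0 < y) :
    Eker b y x ≤ (2 * Real.sqrt Real.pi * 256 * 64) * (1 + y ^ 2)⁻¹ * Real.exp (-(1 / 4) * x ^ 2) := by
  unfold Eker
  by_cases hx : x ∈ Set.Ioi (-b)
  swap
  · rw [Set.indicator_of_notMem hx]; positivity
  rw [Set.indicator_of_mem hx]
  have hx : -b < x := hx
  have hyb : 0 < y ^ 2 / b ^ 3 := by positivity
  have hab : b ≤ afun b y := by unfold afun; linarith
  have haz : afun b y ≤ zfun b y x := by unfold zfun; linarith [Real.sqrt_nonneg ((y ^ 2 / b ^ 3) * (afun b y + x))]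
  have hz : 0 < zfun b y x := by linarith
  have h2z : 0 < Real.sqrt 2 * zfun b y x := by positivity
  have hm := mills_le h2z
  have hm2 : gphi (Real.sqrt 2 * zfun b y x) / (Real.sqrt 2 * zfun b y x) ≤
      gphi (Real.sqrt 2 * zfun b y x) / (Real.sqrt 2 * b) := by
    have := gphi_pos (Real.sqrt 2 * zfun b y x)
    gcongr; linarith
  have hb0 := gphi_pos b
  have ha0 := gphi_pos (afun b y)
  have hx0 := gphi_pos x
  set X := (afun b y ^ 2 - b ^ 2) / 2 + (zfun b y x ^ 2 - b ^ 2) with hX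
  have key : b ^ 4 / gphi b ^ 3 * (gphi (afun b y) * (2 * y / b ^ 3)) *
      (gphi x * stdNormalCDF (-(Real.sqrt 2 * zfun b y x))) ≤
      2 * y * gphi x * (Real.sqrt Real.pi * Real.exp (-X)) := by
    calc _ ≤ b ^ 4 / gphi b ^ 3 * (gphi (afun b y) * (2 * y / b ^ 3)) *
      (gphi x * (gphi (Real.sqrt 2 * zfun b y x) / (Real.sqrt 2 * b))) := by
          gcongr; exact hm.trans hm2
      _ = 2 * y * gphi x / Real.sqrt 2 * (gphi (afun b y) * gphi (Real.sqrt 2 * zfun b y x) / gphi b ^ 3) := by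
          field_simp
      _ = _ := by
          rw [gphi_ratio, Real.sqrt_mul two_pos.le, ← hX]
          field_simp
  have hzs := zfun_sub (x := x) hb hy.le
  have hs0 := Real.sqrt_nonneg (1 + y ^ 2 / b ^ 4 + x / b)
  have hz2 : 2 * (b * (zfun b y x - b)) ≤ zfun b y x ^ 2 - b ^ 2 := by nlinarith [sq_nonneg (zfun b y x - b)]
  have ha2 : 0 ≤ (afun b y ^ 2 - b ^ 2) / 2 := by nlinarith
  have hyb2 : 0 < y ^ 2 / b ^ 2 := by positivity
  have hXbd : Real.exp (-X) ≤ 256 * (1 + x ^ 2) ^ 2 / (1 + y ^ 2) ^ 2 := by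
    by_cases hc : -(b / 2) ≤ x
    · have h1 : y ≤ X := by
        have h3 : 1 / 2 ≤ Real.sqrt (1 + y ^ 2 / b ^ 4 + x / b) := by
          apply Real.le_sqrt_of_sq_le
          have : -(1 / 2) ≤ x / b := by rw [le_div_iff₀ hb]; linarith
          have : 0 < y ^ 2 / b ^ 4 := by positivity
          linarith
        nlinarith
      calc Real.exp (-X) ≤ Real.exp (-y) := Real.exp_le_exp.2 (by linarith)
        _ ≤ 256 / (1 + y ^ 2) ^ 2 := exp_bd4 hy.le
        _ ≤ _ := by
          gcongr
          have : 1 ≤ (1 + x ^ 2) ^ 2 := one_le_pow₀ (by nlinarith [sq_nonneg x])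
          linarith
    · push Not at hc
      have hxn : x < 0 := by linarith
      have hx2 : 0 < x ^ 2 := by nlinarith
      have hbx : b ^ 2 ≤ 4 * x ^ 2 := by nlinarith
      set s := y ^ 2 / (4 * x ^ 2) with hs
      have hs0' : 0 ≤ s := by positivity
      have h1 : s ≤ X := by
        have : s ≤ y ^ 2 / b ^ 2 := by rw [hs]; gcongr
        nlinarith [mul_nonneg hy.le hs0]
      have h4 : (1 + y ^ 2) ≤ 4 * (1 + x ^ 2) * (1 + s) := by
        have : s * x ^ 2 = y ^ 2 / 4 := by rw [hs]; have := hxn.ne; field_simp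
        nlinarith
      calc Real.exp (-X) ≤ Real.exp (-s) := Real.exp_le_exp.2 (by linarith)
        _ ≤ 4 / (1 + s) ^ 2 := exp_bd hs0'
        _ ≤ _ := by
          rw [div_le_div_iff₀ (by positivity) (by positivity)]
          have := pow_le_pow_left₀ (by positivity) h4 2
          have e : (4 * (1 + x ^ 2) * (1 + s)) ^ 2 = 16 * ((1 + x ^ 2) ^ 2 * (1 + s) ^ 2) := by ring
          have e2 : 0 ≤ (1 + x ^ 2) ^ 2 * (1 + s) ^ 2 := by positivity
          rw [e] at this
          linarith
  have hgx : gphi x * (1 + x ^ 2) ^ 2 ≤ 64 * Real.exp (-(1 / 4) * x ^ 2) := by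
    have h1 : gphi x ≤ Real.exp (-x ^ 2 / 2) := by
      unfold gphi
      apply div_le_self (Real.exp_pos _).le
      rw [Real.one_le_sqrt]
      nlinarith [Real.pi_gt_three]
    have h2 := exp_bd (s := x ^ 2 / 4) (by positivity)
    have h3 : Real.exp (-x ^ 2 / 2) = Real.exp (-(1 / 4) * x ^ 2) * Real.exp (-(x ^ 2 / 4)) := by
      rw [← Real.exp_add]; congr 1; ring
    have h4 : Real.exp (-(x ^ 2 / 4)) * (1 + x ^ 2) ^ 2 ≤ 64 := by
      rw [le_div_iff₀ (by positivity)] at h2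
      have : (1 + x ^ 2) ^ 2 ≤ 16 * (1 + x ^ 2 / 4) ^ 2 := by nlinarith [sq_nonneg x]
      nlinarith [Real.exp_pos (-(x ^ 2 / 4))]
    calc gphi x * (1 + x ^ 2) ^ 2 ≤ Real.exp (-x ^ 2 / 2) * (1 + x ^ 2) ^ 2 := by gcongr
      _ = Real.exp (-(1 / 4) * x ^ 2) * (Real.exp (-(x ^ 2 / 4)) * (1 + x ^ 2) ^ 2) := by rw [h3]; ring
      _ ≤ Real.exp (-(1 / 4) * x ^ 2) * 64 := by gcongr
      _ = _ := by ring
  have hyy : y / (1 + y ^ 2) ^ 2 ≤ (1 + y ^ 2)⁻¹ := by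
    rw [div_le_iff₀ (by positivity), sq (1 + y ^ 2), ← mul_assoc, inv_mul_cancel₀ (by positivity)]
    nlinarith [sq_nonneg (y - 1)]
  calc _ ≤ 2 * y * gphi x * (Real.sqrt Real.pi * Real.exp (-X)) := key
    _ ≤ 2 * y * gphi x * (Real.sqrt Real.pi * (256 * (1 + x ^ 2) ^ 2 / (1 + y ^ 2) ^ 2)) := by gcongr
    _ = 2 * Real.sqrt Real.pi * 256 * (y / (1 + y ^ 2) ^ 2) * (gphi x * (1 + x ^ 2) ^ 2) := by ring
    _ ≤ 2 * Real.sqrt Real.pi * 256 * (1 + y ^ 2)⁻¹ * (64 * Real.exp (-(1 / 4) * x ^ 2)) := by gcongr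
    _ = _ := by ring

lemma inv_pow_tendsto {k : ℕ} (hk : k ≠ 0) (c : ℝ) : Tendsto (fun b : ℝ => c / b ^ k) atTop (𝓝 0) :=
  tendsto_const_nhds.div_atTop (tendsto_pow_atTop hk)

lemma zfun_lim1 {y : ℝ} (hy : 0 < y) (x : ℝ) :
    Tendsto (fun b => b * (zfun b y x - b)) atTop (𝓝 y) := by
  have h1 : Tendsto (fun b : ℝ => y ^ 2 / b ^ 2 + y * Real.sqrt (1 + y ^ 2 / b ^ 4 + x / b)) atTop
      (𝓝 (0 + y * Real.sqrt (1 + 0 + 0))) := by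
    have hx : Tendsto (fun b : ℝ => x / b) atTop (𝓝 0) := tendsto_const_nhds.div_atTop tendsto_id
    exact (inv_pow_tendsto two_ne_zero _).add
      ((((inv_pow_tendsto four_ne_zero _).const_add 1).add hx).sqrt.const_mul y)
  simp only [add_zero, Real.sqrt_one, mul_one, zero_add] at h1
  refine h1.congr' ?_
  filter_upwards [eventually_gt_atTop 0] with b hb
  rw [zfun_sub hb hy.le]

lemma zfun_lim2 {y : ℝ} (hy : 0 < y) (x : ℝ) :
    Tendsto (fun b => zfun b y x - b) atTop (𝓝 0) := by
  have := (zfun_lim1 hy x).div_atTop (tendsto_id (α := ℝ))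
  refine this.congr' ?_
  filter_upwards [eventually_gt_atTop 0] with b hb
  simp only [id]
  field_simp

lemma zfun_lim3 {y : ℝ} (hy : 0 < y) (x : ℝ) :
    Tendsto (fun b => zfun b y x ^ 2 - b ^ 2) atTop (𝓝 (2 * y)) := by
  have := ((zfun_lim1 hy x).const_mul 2).add ((zfun_lim2 hy x).pow 2)
  simp only [ne_eq, OfNat.ofNat_ne_zero, not_false_eq_true, zero_pow, add_zero] at this
  refine this.congr fun b => ?_
  ring

lemma zfun_lim4 {y : ℝ} (hy : 0 < y) (x : ℝ) :
    Tendsto (fun b => zfun b y x) atTop atTop := by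
  have := (zfun_lim2 hy x).add_atTop tendsto_id
  refine this.congr fun b => ?_
  simp

lemma zfun_lim5 {y : ℝ} (hy : 0 < y) (x : ℝ) :
    Tendsto (fun b => b / zfun b y x) atTop (𝓝 1) := by
  have := ((zfun_lim2 hy x).div_atTop (zfun_lim4 hy x)).const_sub 1
  rw [sub_zero] at this
  refine this.congr' ?_
  filter_upwards [(zfun_lim4 hy x).eventually_gt_atTop 0] with b hb
  field_simp
  ring

lemma afun_lim (y : ℝ) : Tendsto (fun b => (afun b y ^ 2 - b ^ 2) / 2) atTop (𝓝 0) := by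
  have h : Tendsto (fun b : ℝ => y ^ 2 / b ^ 2 + (y ^ 4 / 2) / b ^ 6) atTop (𝓝 (0 + 0)) :=
    (inv_pow_tendsto two_ne_zero _).add (inv_pow_tendsto (by norm_num) _)
  rw [add_zero] at h
  refine h.congr' ?_
  filter_upwards [eventually_gt_atTop 0] with b hb
  unfold afun
  field_simp
  ring

lemma Eker_lim {y : ℝ} (hy : 0 < y) (x : ℝ) :
    Tendsto (fun b => Eker b y x) atTop (𝓝 (2 * Real.sqrt Real.pi * (y * Real.exp (-(2 * y))) * gphi x)) := by
  have hM : Tendsto (fun b => stdNormalCDF (-(Real.sqrt 2 * zfun b y x)) * (Real.sqrt 2 * zfun b y x) /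
      gphi (Real.sqrt 2 * zfun b y x)) atTop (𝓝 1) :=
    mills_lim.comp ((zfun_lim4 hy x).const_mul_atTop (by positivity))
  have hE : Tendsto (fun b => Real.exp (-((afun b y ^ 2 - b ^ 2) / 2 + (zfun b y x ^ 2 - b ^ 2)))) atTop
      (𝓝 (Real.exp (-(0 + 2 * y)))) :=
    (Real.continuous_exp.tendsto _).comp ((afun_lim y).add (zfun_lim3 hy x)).neg
  have hall := ((hM.mul hE).mul (zfun_lim5 hy x)).const_mul (2 * y * gphi x * Real.sqrt Real.pi)
  have e : 2 * y * gphi x * Real.sqrt Real.pi * (1 * Real.exp (-(0 + 2 * y)) * 1) =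
    2 * Real.sqrt Real.pi * (y * Real.exp (-(2 * y))) * gphi x := by rw [zero_add]; ring
  rw [e] at hall
  refine hall.congr' ?_
  filter_upwards [eventually_gt_atTop 0, eventually_gt_atTop (-x),
    (zfun_lim4 hy x).eventually_gt_atTop 0] with b hb hx hz
  unfold Eker
  rw [Set.indicator_of_mem (by simp; linarith)]
  have h := gphi_ratio (afun b y) b (zfun b y x)
  have h0 := (gphi_pos b).ne'
  have h1 := (gphi_pos (Real.sqrt 2 * zfun b y x)).ne'
  have h2 : Real.exp (-((afun b y ^ 2 - b ^ 2) / 2 + (zfun b y x ^ 2 - b ^ 2))) =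
      gphi (afun b y) * gphi (Real.sqrt 2 * zfun b y x) / gphi b ^ 3 / (Real.sqrt 2 * Real.sqrt Real.pi) := by
    rw [h, Real.sqrt_mul two_pos.le]; field_simp
  rw [h2]
  field_simp

lemma int_y : ∫ y in Set.Ioi (0:ℝ), y * Real.exp (-(2 * y)) = 1 / 4 := by
  have h := Real.integral_rpow_mul_exp_neg_mul_Ioi (a := 2) (r := 2) two_pos two_pos
  have h3 : ((2:ℝ) - 1) = 1 := by norm_num
  have h2 : Real.Gamma 2 = 1 := Real.Gamma_two
  rw [h2, h3] at h
  simp only [Real.rpow_one] at h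
  rw [h]; norm_num

lemma Eker_int_lim :
    Tendsto (fun b => ∫ y in Set.Ioi (0:ℝ), ∫ x, Eker b y x) atTop (𝓝 (Real.sqrt Real.pi / 2)) := by
  set C := 2 * Real.sqrt Real.pi * 256 * 64 with hC
  have hgi : Integrable (fun x : ℝ => Real.exp (-(1 / 4) * x ^ 2)) := integrable_exp_neg_mul_sq (by norm_num)
  have hbd : ∀ b y x : ℝ, 0 < b → 0 < y → ‖Eker b y x‖ ≤ C * (1 + y ^ 2)⁻¹ * Real.exp (-(1 / 4) * x ^ 2) := by
    intro b y x hb hy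
    rw [Real.norm_of_nonneg (Eker_nonneg hb hy)]
    exact Eker_bound hb hy
  have hlim : Real.sqrt Real.pi / 2 =
      ∫ y in Set.Ioi (0:ℝ), ∫ x, 2 * Real.sqrt Real.pi * (y * Real.exp (-(2 * y))) * gphi x := by
    simp_rw [integral_const_mul, gphi_integral, mul_one]
    rw [integral_const_mul, int_y]; ring
  rw [hlim]
  refine tendsto_integral_filter_of_dominated_convergence
    (fun y => C * (1 + y ^ 2)⁻¹ * ∫ x : ℝ, Real.exp (-(1 / 4) * x ^ 2)) ?_ ?_ ?_ ?_
  · refine Eventually.of_forall fun b => ?_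
    exact ((Eker_meas b).stronglyMeasurable.integral_prod_right').aestronglyMeasurable
  · filter_upwards [eventually_gt_atTop 0] with b hb
    filter_upwards [ae_restrict_mem measurableSet_Ioi] with y hy
    rw [← integral_const_mul]
    refine norm_integral_le_of_norm_le (hgi.const_mul _) (Eventually.of_forall fun x => hbd b y x hb hy)
  · exact ((integrable_inv_one_add_sq.const_mul C).mul_const _).integrableOn
  · filter_upwards [ae_restrict_mem measurableSet_Ioi] with y hy
    refine tendsto_integral_filter_of_dominated_convergence
      (fun x => C * (1 + y ^ 2)⁻¹ * Real.exp (-(1 / 4) * x ^ 2)) ?_ ?_ ?_ ?_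
    · refine Eventually.of_forall fun b => ?_
      exact ((Eker_meas b).comp measurable_prodMk_left).aestronglyMeasurable
    · filter_upwards [eventually_gt_atTop 0] with b hb
      exact Eventually.of_forall fun x => hbd b y x hb hy
    · exact hgi.const_mul _
    · exact Eventually.of_forall fun x => Eker_lim hy x

/-- `√(1 - log Φ(-b)) / b → 1/√2`. -/
lemma log_lim : Tendsto (fun b => Real.sqrt (1 - Real.log (stdNormalCDF (-b))) / b) atTop
    (𝓝 (Real.sqrt (1 / 2))) := by
  have h1 : Tendsto (fun b => Real.log (stdNormalCDF (-b) * b / gphi b)) atTop (𝓝 0) := by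
    have := (Real.continuousAt_log one_ne_zero).tendsto.comp mills_lim
    rw [Real.log_one] at this
    exact this
  have hlog : Tendsto (fun b : ℝ => Real.log b / b ^ 2) atTop (𝓝 0) := by
    have := (Real.isLittleO_log_id_atTop.tendsto_div_nhds_zero).mul
      (inv_pow_tendsto (k := 1) one_ne_zero 1)
    rw [zero_mul] at this
    refine this.congr fun b => ?_
    simp only [id, pow_one]
    rw [div_mul_div_comm, mul_one, sq]
  have h2 : Tendsto (fun b : ℝ => (1 + Real.log (Real.sqrt (2 * Real.pi))) / b ^ 2 + 1 / 2 + Real.log b / b ^ 2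
      - Real.log (stdNormalCDF (-b) * b / gphi b) / b ^ 2) atTop (𝓝 (0 + 1 / 2 + 0 - 0)) :=
    (((inv_pow_tendsto two_ne_zero _).add_const _).add hlog).sub
      (h1.div_atTop (tendsto_pow_atTop two_ne_zero))
  have h3 := h2.sqrt
  rw [show (0 + 1 / 2 + 0 - 0 : ℝ) = 1 / 2 by norm_num] at h3
  refine h3.congr' ?_
  filter_upwards [eventually_gt_atTop 0] with b hb
  have hg := gphi_pos b
  have hp := Phi_pos (-b)
  have e : Real.log (gphi b) = -b ^ 2 / 2 - Real.log (Real.sqrt (2 * Real.pi)) := by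
    unfold gphi
    rw [Real.log_div (Real.exp_pos _).ne' (by positivity), Real.log_exp]
  rw [Real.log_div (by positivity) hg.ne', Real.log_mul hp.ne' hb.ne', e]
  have e2 : Real.sqrt (1 - Real.log (stdNormalCDF (-b))) / b =
      Real.sqrt ((1 - Real.log (stdNormalCDF (-b))) / b ^ 2) := by
    rw [Real.sqrt_div' _ (by positivity), Real.sqrt_sq hb.le]
  rw [e2]
  congr 1
  field_simp
  ring

/-- The normalised inner integral. -/
noncomputable def Kfun (v : ℝ) : ℝ := Hfun v * Real.sqrt (1 - Real.log v) / v ^ 3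

lemma Kfun_lim_b : Tendsto (fun b => Kfun (stdNormalCDF (-b))) atTop
    (𝓝 (Real.sqrt Real.pi / 2 * Real.sqrt (1 / 2))) := by
  have h1 : Tendsto (fun b => (1 - stdNormalCDF (-b))⁻¹) atTop (𝓝 1) := by
    simpa using (PhiN_atTop.const_sub 1).inv₀ (by norm_num)
  have h2 := ((h1.mul Eker_int_lim).mul log_lim).mul ((mills_lim.inv₀ one_ne_zero).pow 3)
  simp only [inv_one, one_pow, mul_one, one_mul] at h2
  refine h2.congr' ?_
  filter_upwards [eventually_gt_atTop 0] with b hb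
  unfold Kfun
  rw [Hfun_Eker hb]
  have := gphi_pos b
  have := Phi_pos (-b)
  have h1 : 1 - stdNormalCDF (-b) ≠ 0 := (sub_pos.2 (Phi_lt_one _)).ne'
  generalize (∫ y in Set.Ioi (0:ℝ), ∫ x, Eker b y x) = J
  field_simp

lemma Kfun_lim : Tendsto Kfun (𝓝[>] 0) (𝓝 (Real.sqrt Real.pi / 2 * Real.sqrt (1 / 2))) := by
  refine (Kfun_lim_b.comp Inv_tendsto).congr' ?_
  filter_upwards [Ioo_mem_nhdsGT (zero_lt_one' ℝ)] with v hv
  simp only [Function.comp, neg_neg]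
  rw [Phi_Inv hv.1 hv.2]

lemma pPair_norm (u v w : ℝ) : ‖pPair u v w‖ ≤ 1 := by
  unfold pPair
  rw [Real.norm_of_nonneg (Phi_pos _).le]
  exact (Phi_lt_one _).le

lemma Gavg_norm {u v : ℝ} (hv : v < 1) : ‖Gavg u v‖ ≤ 1 := by
  unfold Gavg
  have h : ‖∫ w in Set.Ioo v 1, pPair u v w‖ ≤ 1 * volume.real (Set.Ioo v 1) :=
    norm_setIntegral_le_of_norm_le_const (by simp) (fun w _ => pPair_norm u v w)
  rw [Real.volume_real_Ioo_of_le hv.le, one_mul] at h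
  have h1 : 0 < 1 - v := by linarith
  rw [norm_mul, Real.norm_of_nonneg (by positivity), one_div, inv_mul_le_iff₀ h1]
  linarith

lemma Hfun_norm {v : ℝ} (h0 : 0 < v) (hv : v < 1) : ‖Hfun v‖ ≤ 1 := by
  unfold Hfun
  have h : ‖∫ u in Set.Ioo 0 v, Gavg u v‖ ≤ 1 * volume.real (Set.Ioo 0 v) :=
    norm_setIntegral_le_of_norm_le_const (by simp) (fun w _ => Gavg_norm hv)
  rw [Real.volume_real_Ioo_of_le h0.le, one_mul] at h
  linarith

lemma Kfun_bdd : ∃ C : ℝ, 0 ≤ C ∧ ∀ v ∈ Set.Ioo (0:ℝ) 1, ‖Kfun v‖ ≤ C := by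
  set c := Real.sqrt Real.pi / 2 * Real.sqrt (1 / 2) with hc
  have h := Kfun_lim.norm.eventually (gt_mem_nhds (lt_add_one _))
  obtain ⟨d, hd, hd2⟩ := mem_nhdsGT_iff_exists_Ioo_subset.1 h
  have hd : 0 < d := hd
  refine ⟨max (‖c‖ + 1) (1 * Real.sqrt (1 - Real.log d) / d ^ 3), le_max_of_le_left (by positivity), ?_⟩
  intro v hv
  by_cases hvd : v < d
  · exact le_max_of_le_left (le_of_lt (hd2 ⟨hv.1, hvd⟩))
  · push Not at hvd
    apply le_max_of_le_right
    unfold Kfun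
    rw [norm_div, norm_mul, Real.norm_of_nonneg (Real.sqrt_nonneg _),
      Real.norm_of_nonneg (pow_nonneg hv.1.le 3)]
    have h1 := Hfun_norm hv.1 hv.2
    gcongr

lemma Hfun_meas : Measurable Hfun := by
  have hp : Measurable (fun q : (ℝ × ℝ) × ℝ => pPair q.1.2 q.1.1 q.2) := by
    unfold pPair
    have h1 := Inv_meas
    have h2 := Phi_cont.measurable
    fun_prop
  have hG : Measurable (fun q : ℝ × ℝ => Gavg q.2 q.1) := by
    have hs : MeasurableSet {q : (ℝ × ℝ) × ℝ | q.1.1 < q.2 ∧ q.2 < 1} := by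
      rw [Set.setOf_and]
      exact (measurableSet_lt (by fun_prop) (by fun_prop)).inter
        (measurableSet_lt (by fun_prop) (by fun_prop))
    have h3 := (hp.indicator hs).stronglyMeasurable.integral_prod_right' (ν := volume)
    have e : (fun q : ℝ × ℝ => Gavg q.2 q.1) = fun q : ℝ × ℝ => (1 / (1 - q.1)) *
        ∫ w, ({q : (ℝ × ℝ) × ℝ | q.1.1 < q.2 ∧ q.2 < 1}.indicator
          (fun q : (ℝ × ℝ) × ℝ => pPair q.1.2 q.1.1 q.2)) (q, w) := by
      funext q
      unfold Gavg
      rw [← integral_indicator measurableSet_Ioo]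
      rfl
    rw [e]
    have h4 := h3.measurable
    exact Measurable.mul (by fun_prop) h4
  have hs : MeasurableSet {q : ℝ × ℝ | 0 < q.2 ∧ q.2 < q.1} := by
      rw [Set.setOf_and]
      exact (measurableSet_lt (by fun_prop) (by fun_prop)).inter
        (measurableSet_lt (by fun_prop) (by fun_prop))
  have h3 := (hG.indicator hs).stronglyMeasurable.integral_prod_right' (ν := volume)
  have e : Hfun = fun v => ∫ u, ({q : ℝ × ℝ | 0 < q.2 ∧ q.2 < q.1}.indicator
          (fun q : ℝ × ℝ => Gavg q.2 q.1)) (v, u) := by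
    funext v
    unfold Hfun
    rw [← integral_indicator measurableSet_Ioo]
    rfl
  rw [e]
  exact h3.measurable

/-- The rescaled outer integrand. -/
noncomputable def gn (n : ℕ) (t : ℝ) : ℝ :=
  Real.sqrt (Real.log n) * (n : ℝ) ^ 3 *
    (Set.Iio (1:ℝ)).indicator (fun v => (1 - v) ^ (n - 2) * Hfun v) ((n : ℝ)⁻¹ * t)

lemma gn_meas (n : ℕ) : Measurable (gn n) := by
  unfold gn
  have h : Measurable ((Set.Iio (1:ℝ)).indicator (fun v => (1 - v) ^ (n - 2) * Hfun v)) := by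
    apply Measurable.indicator _ measurableSet_Iio
    exact Measurable.mul (by fun_prop) Hfun_meas
  exact (h.comp (by fun_prop : Measurable fun t : ℝ => (n : ℝ)⁻¹ * t)).const_mul _

lemma gn_eq {n : ℕ} (hn : 0 < n) {t : ℝ} (ht : 0 < t) (htn : t < n) :
    gn n t = t ^ 3 * (1 - t / n) ^ (n - 2) * Kfun ((n : ℝ)⁻¹ * t) *
      (Real.sqrt (Real.log n) / Real.sqrt (1 - Real.log t + Real.log n)) := by
  have hn' : (0:ℝ) < n := by exact_mod_cast hn
  have hlt : (n : ℝ)⁻¹ * t < 1 := by rw [inv_mul_lt_iff₀ hn']; linarith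
  have hl : Real.log ((n : ℝ)⁻¹ * t) = Real.log t - Real.log n := by
    rw [Real.log_mul (by positivity) ht.ne', Real.log_inv]; ring
  unfold gn Kfun
  rw [Set.indicator_of_mem (by exact hlt), hl]
  have hlog : Real.log t < Real.log n := Real.log_lt_log ht htn
  have e : 1 - (Real.log t - Real.log n) = 1 - Real.log t + Real.log n := by ring
  rw [e]
  have hs : 0 < Real.sqrt (1 - Real.log t + Real.log n) := Real.sqrt_pos.2 (by linarith)
  have e2 : (n : ℝ)⁻¹ * t = t / n := by ring
  rw [e2]
  field_simp

lemma gn_bound {C : ℝ} (hC0 : 0 ≤ C) (hC : ∀ v ∈ Set.Ioo (0:ℝ) 1, ‖Kfun v‖ ≤ C) {n : ℕ} (hn : 3 ≤ n)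
    {t : ℝ} (ht : 0 < t) : ‖gn n t‖ ≤ C * 24 ^ 4 * Real.exp (-(1 / 6) * t) := by
  have hn' : (3:ℝ) ≤ n := by exact_mod_cast hn
  have hn0 : (0:ℝ) < n := by linarith
  by_cases htn : t < n
  swap
  · unfold gn
    rw [Set.indicator_of_notMem]
    · simp; positivity
    · simp only [Set.mem_Iio, not_lt] at htn ⊢
      rw [le_inv_mul_iff₀ hn0]; linarith
  rw [gn_eq (by omega) ht htn]
  have hlt : (n : ℝ)⁻¹ * t < 1 := by rw [inv_mul_lt_iff₀ hn0]; linarith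
  have hK := hC _ ⟨by positivity, hlt⟩
  have htn1 : t / n < 1 := by rw [div_lt_one hn0]; exact htn
  have hpow : (1 - t / n) ^ (n - 2) ≤ Real.exp (-(1 / 3) * t) := by
    have h1 : 1 - t / n ≤ Real.exp (-(t / n)) := Real.one_sub_le_exp_neg _
    calc (1 - t / n) ^ (n - 2) ≤ Real.exp (-(t / n)) ^ (n - 2) :=
          pow_le_pow_left₀ (by linarith) h1 _
      _ = Real.exp ((n - 2 : ℕ) * (-(t / n))) := (Real.exp_nat_mul _ _).symm
      _ ≤ _ := by
        apply Real.exp_le_exp.2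
        rw [Nat.cast_sub (by omega)]
        push_cast
        have : ((n:ℝ) - 2) * -(t / n) = -(((n:ℝ) - 2) / n) * t := by ring
        rw [this]
        have h2 : 1 / 3 ≤ ((n:ℝ) - 2) / n := by
          rw [div_le_div_iff₀ (by norm_num) hn0]; linarith
        nlinarith
  have hlog : Real.log t < Real.log n := Real.log_lt_log ht htn
  have hlt2 : Real.log t ≤ t := (Real.log_le_sub_one_of_pos ht).trans (by linarith)
  have hs : 0 < Real.sqrt (1 - Real.log t + Real.log n) := Real.sqrt_pos.2 (by linarith)
  have hrat : Real.sqrt (Real.log n) / Real.sqrt (1 - Real.log t + Real.log n) ≤ 1 + t := by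
    rw [div_le_iff₀ hs]
    have : (1 + t) * Real.sqrt (1 - Real.log t + Real.log n) =
        Real.sqrt ((1 + t) ^ 2 * (1 - Real.log t + Real.log n)) := by
      rw [Real.sqrt_mul (by positivity), Real.sqrt_sq (by positivity)]
    rw [this]
    apply Real.sqrt_le_sqrt
    have hL : 0 < Real.log n - Real.log t := by linarith
    nlinarith [mul_pos ht hL, mul_pos (mul_pos ht ht) hL]
  rw [norm_mul, norm_mul, norm_mul, Real.norm_of_nonneg (by positivity : 0 ≤ t ^ 3),
    Real.norm_of_nonneg (pow_nonneg (by linarith) _ : 0 ≤ (1 - t / n) ^ (n - 2)),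
    Real.norm_of_nonneg (by positivity :
      0 ≤ Real.sqrt (Real.log n) / Real.sqrt (1 - Real.log t + Real.log n))]
  have hexp : (1 + t) ^ 4 ≤ 24 ^ 4 * Real.exp (t / 6) := by
    have h : t / 24 + 1 ≤ Real.exp (t / 24) := Real.add_one_le_exp _
    have h2 : Real.exp (t / 6) = Real.exp (t / 24) ^ 4 := by
      rw [← Real.exp_nat_mul]; congr 1; push_cast; ring
    rw [h2, ← mul_pow]
    exact pow_le_pow_left₀ (by positivity) (by linarith) 4
  have ht3 : t ^ 3 ≤ (1 + t) ^ 3 := pow_le_pow_left₀ ht.le (by linarith) 3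
  calc _ ≤ (1 + t) ^ 3 * Real.exp (-(1 / 3) * t) * C * (1 + t) := by gcongr
    _ = C * (1 + t) ^ 4 * Real.exp (-(1 / 3) * t) := by ring
    _ ≤ C * (24 ^ 4 * Real.exp (t / 6)) * Real.exp (-(1 / 3) * t) := by gcongr
    _ = C * 24 ^ 4 * (Real.exp (t / 6) * Real.exp (-(1 / 3) * t)) := by ring
    _ = _ := by rw [← Real.exp_add]; congr 2; ring

lemma gn_lim {t : ℝ} (ht : 0 < t) : Tendsto (fun n => gn n t) atTop
    (𝓝 (Real.sqrt Real.pi / 2 * Real.sqrt (1 / 2) * (t ^ 3 * Real.exp (-t)))) := by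
  have hnat : Tendsto (fun n : ℕ => (n : ℝ)) atTop atTop := tendsto_natCast_atTop_atTop
  have hdiv : Tendsto (fun n : ℕ => 1 - t / (n : ℝ)) atTop (𝓝 1) := by
    simpa using (tendsto_const_nhds.div_atTop hnat : Tendsto (fun n : ℕ => t / (n : ℝ)) atTop (𝓝 0)).const_sub 1
  have hpow : Tendsto (fun n : ℕ => (1 - t / (n : ℝ)) ^ (n - 2)) atTop (𝓝 (Real.exp (-t))) := by
    have h1 := Real.tendsto_one_add_div_pow_exp (-t)
    have h2 := h1.div (hdiv.pow 2) (by norm_num)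
    simp only [one_pow, div_one] at h2
    refine h2.congr' ?_
    filter_upwards [eventually_ge_atTop 2, hnat.eventually_gt_atTop t] with n hn htn
    have hpos : 0 < 1 - t / (n : ℝ) := by
      rw [sub_pos, div_lt_one (ht.trans htn)]; exact htn
    simp only [Pi.div_apply]
    rw [neg_div, ← sub_eq_add_neg, div_eq_iff (by positivity), ← pow_add]
    congr 1; omega
  have hK : Tendsto (fun n : ℕ => Kfun ((n : ℝ)⁻¹ * t)) atTop (𝓝 (Real.sqrt Real.pi / 2 * Real.sqrt (1 / 2))) := by
    apply Kfun_lim.comp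
    rw [tendsto_nhdsWithin_iff]
    constructor
    · simpa using (tendsto_inv_atTop_zero.comp hnat).mul_const t
    · filter_upwards [eventually_gt_atTop 0] with n hn
      have : (0:ℝ) < n := by exact_mod_cast hn
      simp only [Set.mem_Ioi]; positivity
  have hln : Tendsto (fun n : ℕ => Real.log n) atTop atTop := Real.tendsto_log_atTop.comp hnat
  have hr : Tendsto (fun n : ℕ => Real.sqrt (Real.log n) / Real.sqrt (1 - Real.log t + Real.log n)) atTop (𝓝 1) := by
    have h1 : Tendsto (fun n : ℕ => ((1 - Real.log t) / Real.log n + 1)⁻¹) atTop (𝓝 1) := by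
      simpa using ((tendsto_const_nhds.div_atTop hln :
        Tendsto (fun n : ℕ => (1 - Real.log t) / Real.log n) atTop (𝓝 0)).add_const 1).inv₀ (by norm_num)
    have h2 := h1.sqrt
    rw [Real.sqrt_one] at h2
    refine h2.congr' ?_
    filter_upwards [hln.eventually_gt_atTop 0] with n hn
    rw [← Real.sqrt_div hn.le]
    congr 1
    rw [div_add_one hn.ne', inv_div]
  have hall := ((hpow.const_mul (t ^ 3)).mul hK).mul hr
  have e : t ^ 3 * Real.exp (-t) * (Real.sqrt Real.pi / 2 * Real.sqrt (1 / 2)) * 1 =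
    Real.sqrt Real.pi / 2 * Real.sqrt (1 / 2) * (t ^ 3 * Real.exp (-t)) := by ring
  rw [e] at hall
  refine hall.congr' ?_
  filter_upwards [eventually_gt_atTop 0, hnat.eventually_gt_atTop t] with n hn htn
  rw [gn_eq hn ht htn]

lemma int_t : ∫ t in Set.Ioi (0:ℝ), t ^ 3 * Real.exp (-t) = 6 := by
  have h := Real.integral_rpow_mul_exp_neg_mul_Ioi (a := 4) (r := 1) four_pos one_pos
  have h3 : ((4:ℝ) - 1) = (3 : ℕ) := by norm_num
  have h2 : Real.Gamma 4 = 6 := by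
    rw [show (4:ℝ) = (3:ℕ) + 1 by norm_num, Real.Gamma_nat_eq_factorial]
    norm_num [Nat.factorial]
  rw [h2, h3] at h
  simp only [Real.rpow_natCast, one_mul] at h
  rw [h]; norm_num

lemma gn_int_lim : Tendsto (fun n => ∫ t in Set.Ioi (0:ℝ), gn n t) atTop
    (𝓝 (3 * Real.sqrt (Real.pi / 2))) := by
  obtain ⟨C, hC0, hC⟩ := Kfun_bdd
  have hlim : 3 * Real.sqrt (Real.pi / 2) = ∫ t in Set.Ioi (0:ℝ),
      Real.sqrt Real.pi / 2 * Real.sqrt (1 / 2) * (t ^ 3 * Real.exp (-t)) := by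
    rw [integral_const_mul, int_t, Real.sqrt_div Real.pi_pos.le, Real.sqrt_div zero_le_one, Real.sqrt_one]
    ring
  rw [hlim]
  refine tendsto_integral_filter_of_dominated_convergence
    (fun t => C * 24 ^ 4 * Real.exp (-(1 / 6) * t)) ?_ ?_ ?_ ?_
  · exact Eventually.of_forall fun n => (gn_meas n).aestronglyMeasurable
  · filter_upwards [eventually_ge_atTop 3] with n hn
    filter_upwards [ae_restrict_mem measurableSet_Ioi] with t ht
    exact gn_bound hC0 hC hn ht
  · exact (exp_neg_integrableOn_Ioi 0 (by norm_num)).const_mul _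
  · filter_upwards [ae_restrict_mem measurableSet_Ioi] with t ht
    exact gn_lim ht

/-- Asymptotics of the averaged function for `A_n`: with
`I_n = n(n−1)(n−2)∫₀¹∫₀^v (1−v)^{n−2} G(u,v) du dv`, one has
`n√(log n) · I_n → 3√(π/2)`. -/
theorem averaged_function_A_asymptotics :
    Tendsto (fun n : ℕ =>
        (n : ℝ) * Real.sqrt (Real.log n) *
          ((n : ℝ) * ((n : ℝ) - 1) * ((n : ℝ) - 2) *
            ∫ v in Set.Ioo (0 : ℝ) 1, ∫ u in Set.Ioo (0 : ℝ) v,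
              (1 - v) ^ (n - 2) * Gavg u v))
      atTop (nhds (3 * Real.sqrt (Real.pi / 2))) := by
  have hnat : Tendsto (fun n : ℕ => (n : ℝ)) atTop atTop := tendsto_natCast_atTop_atTop
  have hq : Tendsto (fun n : ℕ => (1 - 1 / (n : ℝ)) * (1 - 2 / (n : ℝ))) atTop (𝓝 1) := by
    have h1 : Tendsto (fun n : ℕ => 1 / (n : ℝ)) atTop (𝓝 0) := tendsto_const_nhds.div_atTop hnat
    have h2 : Tendsto (fun n : ℕ => 2 / (n : ℝ)) atTop (𝓝 0) := tendsto_const_nhds.div_atTop hnat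
    simpa using (h1.const_sub 1).mul (h2.const_sub 1)
  have h := hq.mul gn_int_lim
  rw [one_mul] at h
  refine h.congr' ?_
  filter_upwards [eventually_ge_atTop 3] with n hn
  have hn0 : (0:ℝ) < n := by exact_mod_cast (by omega : 0 < n)
  have e1 : (∫ v in Set.Ioo (0 : ℝ) 1, ∫ u in Set.Ioo (0 : ℝ) v, (1 - v) ^ (n - 2) * Gavg u v) =
      ∫ v in Set.Ioi (0:ℝ), (Set.Iio (1:ℝ)).indicator (fun v => (1 - v) ^ (n - 2) * Hfun v) v := by
    rw [setIntegral_indicator measurableSet_Iio, Set.Ioi_inter_Iio]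
    simp_rw [integral_const_mul]
    rfl
  have e2 := integral_comp_mul_left_Ioi
    ((Set.Iio (1:ℝ)).indicator (fun v => (1 - v) ^ (n - 2) * Hfun v)) 0 (inv_pos.2 hn0)
  rw [mul_zero, inv_inv, smul_eq_mul] at e2
  rw [e1]
  unfold gn
  rw [integral_const_mul, e2]
  generalize (∫ v in Set.Ioi (0:ℝ), (Set.Iio (1:ℝ)).indicator (fun v => (1 - v) ^ (n - 2) * Hfun v) v) = J
  field_simp
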